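/- Assume the solution is nontrivial (S is not a horizontal line) and u² + v² ≠ 0 at every point of the closure of Ω. Then P(x, y) > Patm at every point (x, y) of the closure of Ω with y < minη, i.e., at all depths below the troughs. -/

import Mathlib

open Set

/-- Partial derivative in the horizontal direction. -/
noncomputable def pdX (f : ℝ × ℝ → ℝ) (p : ℝ × ℝ) : ℝ := fderiv ℝ f p (1, 0)

/-- Partial derivative in the vertical direction. -/
noncomputable def pdY (f : ℝ × ℝ → ℝ) (p : ℝ × ℝ) : ℝ := fderiv ℝ f p (0, 1)

/-- A general (possibly overturning, possibly asymmetric) horizontally `2L`-periodic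
steady water wave.  The free surface `S` is the non-self-intersecting `C²` curve
parametrized by `s ↦ (X s, Y s)`, lying above the bed `B = {y = -d}`, and the fluid
domain `Ω` is the open connected `2L`-periodic region whose boundary is `S ∪ B`.
The flow `(u, v)` with pressure `P` solves the steady Euler equations in `Ω`, is
tangent to `S`, has `P = Patm` on `S` and `v = 0` on `B`; `ψ` is a stream function,
vanishing on `S` and equal to the constant `m` on `B`. -/
structure GenPeriodicFlow (g Patm L d : ℝ) : Type where
  X : ℝ → ℝ
  Y : ℝ → ℝ
  T : ℝ
  u : ℝ × ℝ → ℝ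
  v : ℝ × ℝ → ℝ
  P : ℝ × ℝ → ℝ
  ψ : ℝ × ℝ → ℝ
  m : ℝ
  Ω : Set (ℝ × ℝ)
  T_pos : 0 < T
  X_smooth : ContDiff ℝ 2 X
  Y_smooth : ContDiff ℝ 2 Y
  regular : ∀ s, deriv X s ^ 2 + deriv Y s ^ 2 ≠ 0
  X_per : ∀ s, X (s + T) = X s + 2 * L
  Y_per : ∀ s, Y (s + T) = Y s
  S_above_bed : ∀ s, -d < Y s
  S_simple : ∀ s s', X s = X s' → Y s = Y s' → ∃ n : ℤ, s' = s + n * T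
  Ω_open : IsOpen Ω
  Ω_conn : IsConnected Ω
  Ω_per : ∀ p : ℝ × ℝ, p ∈ Ω ↔ (p.1 + 2 * L, p.2) ∈ Ω
  Ω_frontier : frontier Ω = (range fun s => (X s, Y s)) ∪ {p : ℝ × ℝ | p.2 = -d}
  u_smooth : ContDiff ℝ 1 u
  v_smooth : ContDiff ℝ 1 v
  P_smooth : ContDiff ℝ 2 P
  ψ_smooth : ContDiff ℝ 2 ψ
  u_periodic : ∀ x y, u (x + 2 * L, y) = u (x, y)
  v_periodic : ∀ x y, v (x + 2 * L, y) = v (x, y)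
  P_periodic : ∀ x y, P (x + 2 * L, y) = P (x, y)
  euler_x : ∀ p ∈ Ω, u p * pdX u p + v p * pdY u p = -pdX P p
  euler_y : ∀ p ∈ Ω, u p * pdX v p + v p * pdY v p = -(pdY P p) - g
  incompressible : ∀ p ∈ Ω, pdX u p + pdY v p = 0
  surface_pressure : ∀ s, P (X s, Y s) = Patm
  surface_tangency : ∀ s, u (X s, Y s) * deriv Y s = v (X s, Y s) * deriv X s
  bed_kinematic : ∀ x, v (x, -d) = 0
  psi_x : ∀ p ∈ closure Ω, pdX ψ p = -v p
  psi_y : ∀ p ∈ closure Ω, pdY ψ p = u p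
  psi_surface : ∀ s, ψ (X s, Y s) = 0
  psi_bed : ∀ x, ψ (x, -d) = m

namespace GenPeriodicFlow

variable {g Patm L d : ℝ}

/-- The vorticity `ω = v_x - u_y`. -/
noncomputable def vort (F : GenPeriodicFlow g Patm L d) (p : ℝ × ℝ) : ℝ :=
  pdX F.v p - pdY F.u p

/-- The free surface `S`, as a subset of the plane. -/
def surf (F : GenPeriodicFlow g Patm L d) : Set (ℝ × ℝ) :=
  range fun s => (F.X s, F.Y s)

/-- The maximal surface height `maxη = max_S y`. -/
noncomputable def maxη (F : GenPeriodicFlow g Patm L d) : ℝ := sSup (range F.Y)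

/-- The minimal surface height `minη = min_S y`. -/
noncomputable def minη (F : GenPeriodicFlow g Patm L d) : ℝ := sInf (range F.Y)

/-- The solution is nontrivial: `S` is not a horizontal line. -/
def Nontrivial' (F : GenPeriodicFlow g Patm L d) : Prop := ∃ s s', F.Y s ≠ F.Y s'

/-- `n` is an outward (non-fluid side) normal to `S` at the parameter `s`:
it is orthogonal to the tangent vector and points out of the fluid. -/
def IsOutwardNormalAt (F : GenPeriodicFlow g Patm L d) (n : ℝ × ℝ) (s : ℝ) : Prop :=
  n.1 * deriv F.X s + n.2 * deriv F.Y s = 0 ∧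
  ∃ t₀ > 0, ∀ t, 0 < t → t < t₀ → (F.X s + t * n.1, F.Y s + t * n.2) ∉ closure F.Ω

end GenPeriodicFlow

open Filter Topology


/-- A product whose first factor vanishes at `p` is differentiable at `p` as soon as the second
factor is continuous there. -/
theorem HasFDerivAt.smul_of_eq_zero {E F : Type*} [NormedAddCommGroup E] [NormedSpace ℝ E]
    [NormedAddCommGroup F] [NormedSpace ℝ F] {a : E → ℝ} {a' : E →L[ℝ] ℝ} {b : E → F} {p : E}
    (ha : HasFDerivAt a a' p) (h0 : a p = 0) (hb : ContinuousAt b p) :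
    HasFDerivAt (fun z => a z • b z) (a'.smulRight (b p)) p := by
  have h1 : HasFDerivAt (fun z => a z • b p) (a'.smulRight (b p)) p := ha.smul_const (b p)
  have h2 : HasFDerivAt (fun z => a z • (b z - b p)) (0 : E →L[ℝ] F) p := by
    rw [hasFDerivAt_iff_isLittleO]
    have hO : a =O[𝓝 p] fun z => z - p := by
      simpa [h0] using ha.isBigO_sub
    have ho : (fun z => b z - b p) =o[𝓝 p] fun _ => (1 : ℝ) := by
      rw [Asymptotics.isLittleO_one_iff]
      simpa using Tendsto.sub hb (tendsto_const_nhds (x := b p))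
    have := (hO.norm_right).smul_isLittleO ho
    simpa [h0, Asymptotics.isLittleO_norm_right] using this
  have h3 := h1.add h2
  rw [add_zero] at h3
  refine h3.congr_of_eventuallyEq (Eventually.of_forall fun z => ?_)
  simp [smul_sub]

/-- The pressure Laplacian of a steady incompressible flow, obtained for velocities that are
only `C¹`: near `p` the derivative of `v p * u - u p * v` is itself differentiable at `p`,
so its second derivative there is symmetric. -/
theorem laplacian_eq_of_steady {u v Q : ℝ × ℝ → ℝ} {Ω : Set (ℝ × ℝ)} (hΩ : IsOpen Ω)
    (hu : ContDiff ℝ 1 u) (hv : ContDiff ℝ 1 v) (hQ : ContDiff ℝ 2 Q)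
    (hx : ∀ z ∈ Ω, u z * pdX u z + v z * pdY u z = -pdX Q z)
    (hy : ∀ z ∈ Ω, u z * pdX v z + v z * pdY v z = -pdY Q z)
    (hdiv : ∀ z ∈ Ω, pdX u z + pdY v z = 0) {p : ℝ × ℝ} (hp : p ∈ Ω) :
    fderiv ℝ (fderiv ℝ Q) p (1, 0) (1, 0) + fderiv ℝ (fderiv ℝ Q) p (0, 1) (0, 1)
      = 2 * (pdX u p * pdY v p - pdY u p * pdX v p) := by
  set J : ℝ × ℝ →L[ℝ] ℝ × ℝ :=
    (-ContinuousLinearMap.snd ℝ ℝ ℝ).prod (ContinuousLinearMap.fst ℝ ℝ ℝ) with hJ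
  have hdu : ∀ z, HasFDerivAt u (fderiv ℝ u z) z := fun z =>
    (hu.differentiable one_ne_zero z).hasFDerivAt
  have hdv : ∀ z, HasFDerivAt v (fderiv ℝ v z) z := fun z =>
    (hv.differentiable one_ne_zero z).hasFDerivAt
  have hcu : Continuous (fderiv ℝ u) := hu.continuous_fderiv one_ne_zero
  have hcv : Continuous (fderiv ℝ v) := hv.continuous_fderiv one_ne_zero
  have hdQ : HasFDerivAt (fderiv ℝ Q) (fderiv ℝ (fderiv ℝ Q) p) p :=
    ((hQ.fderiv_right (m := 1) (by norm_num)).differentiable one_ne_zero p).hasFDerivAt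
  set C := ((ContinuousLinearMap.compL ℝ (ℝ × ℝ) (ℝ × ℝ) ℝ).flip J) with hC
  have hθ : HasFDerivAt (fun z => C (fderiv ℝ Q z)) (C.comp (fderiv ℝ (fderiv ℝ Q) p)) p :=
    C.hasFDerivAt.comp p hdQ
  have h1 := ((hdv p).sub_const (v p)).smul_of_eq_zero (sub_self _) hcu.continuousAt
  have h2 := ((hdu p).sub_const (u p)).smul_of_eq_zero (sub_self _) hcv.continuousAt
  have hf : ∀ z, HasFDerivAt (fun z => v p * u z - u p * v z)
      (v p • fderiv ℝ u z - u p • fderiv ℝ v z) z := fun z =>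
    ((hdu z).const_mul (v p)).sub ((hdv z).const_mul (u p))
  have hf' := (hθ.sub (h1.sub h2)).congr_of_eventuallyEq
    (f₁ := fun z => v p • fderiv ℝ u z - u p • fderiv ℝ v z) (by
      filter_upwards [hΩ.mem_nhds hp] with z hz
      have e1 := hx z hz
      have e2 := hy z hz
      have e3 := hdiv z hz
      simp only [pdX, pdY] at e1 e2 e3
      have hneg : fderiv ℝ Q z (-1, 0) = -fderiv ℝ Q z (1, 0) := by
        rw [← map_neg]; simp
      ext
      · simp [hC, hJ]
        linear_combination -e2 + v z * e3
      · simp [hC, hJ, hneg]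
        linear_combination e1 - u z * e3)
  have hs := second_derivative_symmetric hf hf' (1, 0) (0, 1)
  have hneg : fderiv ℝ (fderiv ℝ Q) p (1, 0) (-1, 0)
      = -fderiv ℝ (fderiv ℝ Q) p (1, 0) (1, 0) := by
    rw [← map_neg]; simp
  simp [hC, hJ, hneg] at hs
  simp only [pdX, pdY]
  linear_combination -hs

theorem IsLocalMin.second_deriv_nonneg {φ φ' : ℝ → ℝ} {t a : ℝ} (hm : IsLocalMin φ t)
    (h1 : ∀ s, HasDerivAt φ (φ' s) s) (h2 : HasDerivAt φ' a t) : 0 ≤ a := by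
  by_contra! ha
  have hd : deriv φ = φ' := funext fun s => (h1 s).deriv
  have hdd : deriv (deriv φ) t = a := by rw [hd]; exact h2.deriv
  have hmax : IsLocalMax φ t :=
    isLocalMax_of_deriv_deriv_neg (hdd ▸ ha) hm.deriv_eq_zero (h1 t).continuousAt
  have hc : φ =ᶠ[𝓝 t] fun _ => φ t := by
    filter_upwards [hm, hmax] with s h3 h4 using le_antisymm h4 h3
  have := hc.deriv.deriv_eq
  simp [hdd] at this
  exact ha.ne this

/-- The winding integral `∮ dΓ / (Γ - w)` of a curve `Γ` with velocity `Γ'` around `w`. -/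
noncomputable def cauchyIntegral (Γ Γ' : ℝ → ℂ) (T : ℝ) (w : ℂ) : ℂ :=
  ∫ s in (0 : ℝ)..T, Γ' s / (Γ s - w)

theorem integral_logDeriv_eq_zero {φ φ' : ℝ → ℂ} {T : ℝ} (h : ∀ s, HasDerivAt φ (φ' s) s)
    (hφ : ∀ s, φ s ∈ Complex.slitPlane) (hc : Continuous φ') (hT : φ T = φ 0) :
    ∫ s in (0 : ℝ)..T, φ' s / φ s = 0 := by
  have hcφ : Continuous φ := continuous_iff_continuousAt.2 fun s => (h s).continuousAt
  have hq : Continuous fun s => φ' s / φ s :=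
    hc.div hcφ fun s => Complex.slitPlane_ne_zero (hφ s)
  rw [intervalIntegral.integral_eq_sub_of_hasDerivAt (f := fun s => Complex.log (φ s))
    (fun s _ => (h s).clog_real (hφ s)) (hq.intervalIntegrable _ _), hT, sub_self]

theorem one_sub_mem_slitPlane {z : ℂ} (hz : ‖z‖ < 1) : 1 - z ∈ Complex.slitPlane := by
  have := Complex.mem_slitPlane_of_norm_lt_one (z := -z) (by simpa using hz)
  rwa [← sub_eq_add_neg] at this

section CauchyIntegral

variable {Γ Γ' : ℝ → ℂ} {T : ℝ}

theorem cauchyIntegral_eq (h : ∀ s, HasDerivAt Γ (Γ' s) s) (hc : Continuous Γ')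
    (hT : Γ T = Γ 0) {w w₀ : ℂ} (hw : ∀ s, ‖w - w₀‖ < ‖Γ s - w₀‖) :
    cauchyIntegral Γ Γ' T w = cauchyIntegral Γ Γ' T w₀ := by
  have hcΓ : Continuous Γ := continuous_iff_continuousAt.2 fun s => (h s).continuousAt
  have h0 : ∀ s, Γ s - w₀ ≠ 0 := fun s => norm_pos_iff.1 ((norm_nonneg _).trans_lt (hw s))
  have h1 : ∀ s, Γ s - w ≠ 0 := fun s hs => by
    have := hw s
    rw [← sub_eq_zero.1 hs] at this
    exact lt_irrefl _ this
  have hi := integral_logDeriv_eq_zero (T := T) (φ := fun s => 1 - (w - w₀) / (Γ s - w₀))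
    (φ' := fun s => (w - w₀) * Γ' s / (Γ s - w₀) ^ 2)
    (fun s => by
      refine (((hasDerivAt_const s (w - w₀)).div ((h s).sub_const w₀)
        (h0 s)).const_sub 1).congr_deriv ?_
      ring)
    (fun s => one_sub_mem_slitPlane (by
      rw [norm_div, div_lt_one (norm_pos_iff.2 (h0 s))]
      exact hw s))
    ((continuous_const.mul hc).div ((hcΓ.sub continuous_const).pow 2) fun s => pow_ne_zero 2 (h0 s))
    (by simp [hT])
  have hq : ∀ a, (∀ s, Γ s - a ≠ 0) → Continuous fun s => Γ' s / (Γ s - a) := fun a ha =>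
    hc.div (hcΓ.sub continuous_const) ha
  rw [← sub_eq_zero, cauchyIntegral, cauchyIntegral, ← intervalIntegral.integral_sub
    ((hq w h1).intervalIntegrable _ _) ((hq w₀ h0).intervalIntegrable _ _), ← hi]
  congr 1
  ext s
  have e0 := h0 s
  have e1 := h1 s
  rw [one_sub_div e0, sub_sub_sub_cancel_right]
  field_simp
  ring

theorem cauchyIntegral_eq_zero (h : ∀ s, HasDerivAt Γ (Γ' s) s) (hc : Continuous Γ')
    (hT : Γ T = Γ 0) {w : ℂ} (hw : ∀ s, ‖Γ s‖ < ‖w‖) : cauchyIntegral Γ Γ' T w = 0 := by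
  have h0 : w ≠ 0 := norm_pos_iff.1 ((norm_nonneg _).trans_lt (hw 0))
  rw [← integral_logDeriv_eq_zero (T := T) (φ := fun s => 1 - Γ s / w) (φ' := fun s => -(Γ' s / w))
    (fun s => ((h s).div_const w).const_sub 1)
    (fun s => one_sub_mem_slitPlane (by
      rw [norm_div, div_lt_one (norm_pos_iff.2 h0)]
      exact hw s))
    (hc.div_const w).neg (by simp [hT])]
  unfold cauchyIntegral
  congr 1
  ext s
  rw [one_sub_div h0, ← neg_sub w, div_neg, neg_div]
  field_simp

end CauchyIntegral

theorem cauchyIntegral_zero_exp {f f' : ℝ → ℂ} {T : ℝ} (h : ∀ s, HasDerivAt f (f' s) s)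
    (hc : Continuous f') :
    cauchyIntegral (fun s => Complex.exp (f s)) (fun s => Complex.exp (f s) * f' s) T 0
      = f T - f 0 := by
  rw [← intervalIntegral.integral_eq_sub_of_hasDerivAt (fun s _ => h s)
    (hc.intervalIntegrable _ _)]
  unfold cauchyIntegral
  congr 1
  ext s
  have := Complex.exp_ne_zero (f s)
  rw [sub_zero]
  field_simp

/-- The conformal map `exp (iπ (x + iy) / L)`, which identifies points differing by `2L`
horizontally. -/
noncomputable def periodExp (L : ℝ) (p : ℝ × ℝ) : ℂ :=
  Complex.exp (Real.pi * Complex.I / L * (p.1 + p.2 * Complex.I))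

theorem norm_periodExp (L : ℝ) (p : ℝ × ℝ) : ‖periodExp L p‖ = Real.exp (-(Real.pi / L * p.2)) := by
  have : (Real.pi * Complex.I / L * (p.1 + p.2 * Complex.I) : ℂ)
      = ((-(Real.pi / L * p.2) : ℝ) : ℂ) + ((Real.pi / L * p.1 : ℝ) : ℂ) * Complex.I := by
    push_cast
    linear_combination (Real.pi * p.2 / L : ℂ) * Complex.I_sq
  rw [periodExp, this, Complex.norm_exp]
  simp

theorem norm_periodExp_lt {L : ℝ} (hL : 0 < L) {p q : ℝ × ℝ} (h : q.2 < p.2) :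
    ‖periodExp L p‖ < ‖periodExp L q‖ := by
  rw [norm_periodExp, norm_periodExp, Real.exp_lt_exp, neg_lt_neg_iff]
  exact mul_lt_mul_of_pos_left h (div_pos Real.pi_pos hL)

theorem periodExp_eq {L : ℝ} (hL : 0 < L) {p q : ℝ × ℝ} (h : periodExp L p = periodExp L q) :
    ∃ n : ℤ, p.1 = q.1 + n * (2 * L) ∧ p.2 = q.2 := by
  obtain ⟨n, hn⟩ := Complex.exp_eq_exp_iff_exists_int.1 h
  have hL' : (L : ℂ) ≠ 0 := by exact_mod_cast hL.ne'
  have hpi : (Real.pi : ℂ) ≠ 0 := by exact_mod_cast Real.pi_ne_zero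
  have hn' : (p.1 + p.2 * Complex.I : ℂ) = (q.1 + n * (2 * L)) + q.2 * Complex.I := by
    have hI := Complex.I_ne_zero
    field_simp at hn
    linear_combination hn
  refine ⟨n, ?_, ?_⟩
  · simpa using congrArg Complex.re hn'
  · simpa using congrArg Complex.im hn'

/-- A horizontally periodic curve separates points above it from points below it. -/
theorem periodic_curve_separates {X Y : ℝ → ℝ} {T L : ℝ} (hT : 0 < T) (hL : 0 < L)
    (hX : ContDiff ℝ 1 X) (hY : ContDiff ℝ 1 Y) (hXp : ∀ s, X (s + T) = X s + 2 * L)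
    (hYp : ∀ s, Y (s + T) = Y s) {U : Set (ℝ × ℝ)} (hU : IsOpen U) (hUc : IsPreconnected U)
    (hUS : ∀ s, (X s, Y s) ∉ U) {p q : ℝ × ℝ} (hp : p ∈ U) (hq : q ∈ U)
    (hpY : ∀ s, Y s < p.2) (hqY : ∀ s, q.2 < Y s) : False := by
  set f : ℝ → ℂ := fun s => Real.pi * Complex.I / L * (X s + Y s * Complex.I) with hf
  set f' : ℝ → ℂ := fun s =>
    Real.pi * Complex.I / L * (deriv X s + deriv Y s * Complex.I) with hf'
  have hff' : ∀ s, HasDerivAt f (f' s) s := fun s =>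
    ((((hX.differentiable one_ne_zero s).hasDerivAt.ofReal_comp).add
      ((hY.differentiable one_ne_zero s).hasDerivAt.ofReal_comp.mul_const Complex.I))).const_mul _
  have hcX : Continuous (deriv X) := hX.continuous_deriv le_rfl
  have hcY : Continuous (deriv Y) := hY.continuous_deriv le_rfl
  have hcf' : Continuous f' := by fun_prop
  set Γ : ℝ → ℂ := fun s => Complex.exp (f s) with hΓ
  set Γ' : ℝ → ℂ := fun s => Complex.exp (f s) * f' s with hΓ'
  have hΓE : ∀ s, Γ s = periodExp L (X s, Y s) := fun s => rfl
  have hΓΓ' : ∀ s, HasDerivAt Γ (Γ' s) s := fun s => (hff' s).cexp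
  have hcf : Continuous f := continuous_iff_continuousAt.2 fun s => (hff' s).continuousAt
  have hcΓ : Continuous Γ := continuous_iff_continuousAt.2 fun s => (hΓΓ' s).continuousAt
  have hcΓ' : Continuous Γ' := (Complex.continuous_exp.comp hcf).mul hcf'
  have hfT : ∀ s, f (s + T) = f s + 2 * Real.pi * Complex.I := fun s => by
    have hL' : (L : ℂ) ≠ 0 := by exact_mod_cast hL.ne'
    simp only [hf, hXp, hYp]
    push_cast
    field_simp
    ring
  have hΓp : Function.Periodic Γ T := fun s => by
    simp only [hΓ, hfT]
    exact Complex.exp_periodic _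
  have hΓT : Γ T = Γ 0 := by simpa using hΓp 0
  have htop : cauchyIntegral Γ Γ' T (periodExp L p) = 2 * Real.pi * Complex.I := by
    rw [cauchyIntegral_eq hΓΓ' hcΓ' hΓT (w₀ := 0), cauchyIntegral_zero_exp hff' hcf']
    · have := hfT 0
      rw [zero_add] at this
      rw [this]
      ring
    · intro s
      simpa [hΓE] using norm_periodExp_lt hL (p := p) (q := (X s, Y s)) (hpY s)
  have hbot : cauchyIntegral Γ Γ' T (periodExp L q) = 0 :=
    cauchyIntegral_eq_zero hΓΓ' hcΓ' hΓT fun s =>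
      norm_periodExp_lt hL (p := (X s, Y s)) (q := q) (hqY s)
  have hXn : ∀ (n : ℤ) s, X (s + n * T) = X s + n * (2 * L) := fun n s => by
    have hper : Function.Periodic (fun s => X s - s / T * (2 * L)) T := fun s => by
      simp only [hXp]
      field_simp
      ring
    have := hper.int_mul n s
    field_simp at this
    refine mul_left_cancel₀ hT.ne' ?_
    linear_combination this
  have hYn : ∀ (n : ℤ) s, Y (s + n * T) = Y s := fun n s =>
    (show Function.Periodic Y T from hYp).int_mul n s
  have hloc : ∀ z ∈ U, HasFDerivAt (fun z => cauchyIntegral Γ Γ' T (periodExp L z))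
      (0 : ℝ × ℝ →L[ℝ] ℂ) z := fun z hz => by
    have hcomp : IsClosed (range Γ) := (hΓp.compact_of_continuous hT.ne' hcΓ).isClosed
    have hnot : periodExp L z ∉ range Γ := by
      rintro ⟨s, hs⟩
      obtain ⟨n, h1, h2⟩ := periodExp_eq hL (hs.symm.trans (hΓE s))
      refine hUS (s + n * T) ?_
      rw [hXn, hYn]
      simp only at h1 h2
      rw [← h1, ← h2]
      exact hz
    obtain ⟨δ, hδ, hball⟩ := Metric.isOpen_iff.1 hcomp.isOpen_compl _ hnot
    have hcE : Continuous (periodExp L) := by unfold periodExp; fun_prop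
    refine (hasFDerivAt_const (cauchyIntegral Γ Γ' T (periodExp L z)) z).congr_of_eventuallyEq ?_
    filter_upwards [hcE.continuousAt.preimage_mem_nhds (Metric.ball_mem_nhds _ hδ)] with z' hz'
    refine cauchyIntegral_eq hΓΓ' hcΓ' hΓT fun s => ?_
    rw [← dist_eq_norm, ← dist_eq_norm]
    by_contra! hle
    exact hball (Metric.mem_ball.2 (hle.trans_lt (Metric.mem_ball.1 hz'))) ⟨s, rfl⟩
  have := hU.is_const_of_fderiv_eq_zero hUc
    (fun z hz => (hloc z hz).differentiableAt.differentiableWithinAt)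
    (fun z hz => (hloc z hz).fderiv) hp hq
  rw [htop, hbot] at this
  simp [Real.pi_ne_zero] at this

namespace GenPeriodicFlow

variable {g Patm L d : ℝ} (F : GenPeriodicFlow g Patm L d)

theorem isCompact_range_Y : IsCompact (range F.Y) :=
  Function.Periodic.compact_of_continuous F.Y_per F.T_pos.ne' F.Y_smooth.continuous

theorem minη_le (s : ℝ) : F.minη ≤ F.Y s :=
  csInf_le F.isCompact_range_Y.bddBelow ⟨s, rfl⟩

theorem bed_lt_minη : -d < F.minη := by
  obtain ⟨s, hs⟩ := F.isCompact_range_Y.sInf_mem (range_nonempty _)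
  exact (F.S_above_bed s).trans_eq hs

theorem surface_mem_frontier (s : ℝ) : (F.X s, F.Y s) ∈ frontier F.Ω :=
  F.Ω_frontier ▸ Or.inl ⟨s, rfl⟩

theorem bed_mem_frontier (x : ℝ) : (x, -d) ∈ frontier F.Ω :=
  F.Ω_frontier ▸ Or.inr rfl

theorem notMem_of_mem_frontier {p : ℝ × ℝ} (hp : p ∈ frontier F.Ω) : p ∉ F.Ω := fun h =>
  (F.Ω_open.inter_frontier_eq ▸ mem_inter h hp : p ∈ (∅ : Set (ℝ × ℝ)))

theorem bed_lt {p : ℝ × ℝ} (hp : p ∈ F.Ω) : -d < p.2 := by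
  obtain ⟨q, hqd, hq⟩ := mem_closure_iff.1 (frontier_subset_closure (F.surface_mem_frontier 0))
    {z : ℝ × ℝ | -d < z.2} (isOpen_lt continuous_const continuous_snd) (F.S_above_bed 0)
  by_contra! hle
  obtain ⟨z, hz, hzd⟩ := F.Ω_conn.isPreconnected.intermediate_value hp hq
    continuous_snd.continuousOn ⟨hle, le_of_lt hqd⟩
  have : z = (z.1, -d) := Prod.ext rfl hzd
  exact F.notMem_of_mem_frontier (F.bed_mem_frontier z.1) (this ▸ hz)

theorem exists_mem_below_minη : ∃ q ∈ F.Ω, q.2 < F.minη := by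
  obtain ⟨q, hqd, hq⟩ := mem_closure_iff.1 (frontier_subset_closure (F.bed_mem_frontier 0))
    {z : ℝ × ℝ | z.2 < F.minη} (isOpen_lt continuous_snd continuous_const) F.bed_lt_minη
  exact ⟨q, hq, hqd⟩

theorem strip_subset : {z : ℝ × ℝ | -d < z.2 ∧ z.2 < F.minη} ⊆ F.Ω := by
  obtain ⟨q, hq, hqm⟩ := F.exists_mem_below_minη
  have hlin : IsLinearMap ℝ (Prod.snd : ℝ × ℝ → ℝ) := ⟨fun _ _ => rfl, fun _ _ => rfl⟩
  have hconv : Convex ℝ {z : ℝ × ℝ | -d < z.2 ∧ z.2 < F.minη} :=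
    (convex_halfSpace_gt hlin _).inter (convex_halfSpace_lt hlin _)
  refine hconv.isPreconnected.subset_of_closure_inter_subset F.Ω_open
    ⟨q, ⟨F.bed_lt hq, hqm⟩, hq⟩ ?_
  rintro z ⟨hz, hzd, hzm⟩
  by_contra hzΩ
  have hzf : z ∈ frontier F.Ω := by
    rw [F.Ω_open.frontier_eq]
    exact ⟨hz, hzΩ⟩
  rw [F.Ω_frontier] at hzf
  rcases hzf with ⟨s, rfl⟩ | h
  · exact (F.minη_le s).not_gt hzm
  · exact hzd.ne' h

theorem exists_le_top (hL : 0 < L) : ∃ M, ∀ p ∈ closure F.Ω, p.2 ≤ M := by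
  obtain ⟨M, hM⟩ := F.isCompact_range_Y.bddAbove
  refine ⟨M, fun p hp => ?_⟩
  have : F.Ω ⊆ {z : ℝ × ℝ | z.2 ≤ M} := fun z hz => by
    obtain ⟨q, hq, hqm⟩ := F.exists_mem_below_minη
    by_contra h
    exact periodic_curve_separates F.T_pos hL (F.X_smooth.of_le one_le_two)
      (F.Y_smooth.of_le one_le_two) F.X_per F.Y_per F.Ω_open F.Ω_conn.isPreconnected
      (fun s => F.notMem_of_mem_frontier (F.surface_mem_frontier s)) hz hq
      (fun s => (hM ⟨s, rfl⟩).trans_lt (not_le.1 h))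
      (fun s => hqm.trans_le (F.minη_le s))
  exact closure_minimal this (isClosed_le continuous_snd continuous_const) hp

theorem bed_le {p : ℝ × ℝ} (hp : p ∈ closure F.Ω) : -d ≤ p.2 :=
  closure_minimal (fun _ hz => (F.bed_lt hz).le) (isClosed_le continuous_const continuous_snd) hp

theorem mem_closure_add_period (p : ℝ × ℝ) :
    p ∈ closure F.Ω ↔ (p.1 + 2 * L, p.2) ∈ closure F.Ω := by
  let e : ℝ × ℝ ≃ₜ ℝ × ℝ := (Homeomorph.addRight (2 * L)).prodCongr (Homeomorph.refl ℝ)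
  have h : e ⁻¹' F.Ω = F.Ω := Set.ext fun z => (F.Ω_per z).symm
  have := congrArg (p ∈ ·) (e.preimage_closure F.Ω)
  rw [h] at this
  exact (iff_of_eq this).symm

theorem mem_closure_add_int_mul_period (n : ℤ) (x y : ℝ) :
    (x + n * (2 * L), y) ∈ closure F.Ω ↔ (x, y) ∈ closure F.Ω := by
  have h : Function.Periodic (fun x => (x, y) ∈ closure F.Ω) (2 * L) := fun x =>
    propext (F.mem_closure_add_period (x, y)).symm
  exact iff_of_eq (h.int_mul n x)

/-- A continuous horizontally periodic function attains its minimum on the closure of the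
fluid domain. -/
theorem exists_isMinOn_closure (hL : 0 < L) {G : ℝ × ℝ → ℝ} (hG : Continuous G)
    (hper : ∀ x y, G (x + 2 * L, y) = G (x, y)) :
    ∃ p ∈ closure F.Ω, IsMinOn G (closure F.Ω) p := by
  obtain ⟨M, hM⟩ := F.exists_le_top hL
  have hL2 : 0 < 2 * L := by positivity
  set K : Set (ℝ × ℝ) := closure F.Ω ∩ Icc 0 (2 * L) ×ˢ Icc (-d) M with hK
  have hKc : IsCompact K := (isCompact_Icc.prod isCompact_Icc).inter_left isClosed_closure
  have hred : ∀ p ∈ closure F.Ω, ∃ q ∈ K, G q = G p := by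
    rintro ⟨x, y⟩ hp
    obtain ⟨n, hn, -⟩ := existsUnique_add_zsmul_mem_Ico hL2 x 0
    rw [zsmul_eq_mul] at hn
    refine ⟨(x + n * (2 * L), y), ⟨(F.mem_closure_add_int_mul_period n x y).2 hp,
      ⟨hn.1, by simpa using hn.2.le⟩, F.bed_le (p := (x, y)) hp, hM (x, y) hp⟩, ?_⟩
    exact (show Function.Periodic (fun x => G (x, y)) (2 * L) from fun x => hper x y).int_mul n x
  obtain ⟨q, hq, -⟩ := hred _ (subset_closure F.Ω_conn.nonempty.some_mem)
  obtain ⟨p, hp, hmin⟩ := hKc.exists_isMinOn ⟨q, hq⟩ hG.continuousOn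
  refine ⟨p, hp.1, fun z hz => ?_⟩
  obtain ⟨z', hz', he⟩ := hred z hz
  exact (hmin hz').trans_eq he

theorem exists_coefficient_bound (hL : 0 < L)
    (hstag : ∀ p ∈ closure F.Ω, F.u p ^ 2 + F.v p ^ 2 ≠ 0) :
    ∃ C, 0 ≤ C ∧ ∀ p ∈ closure F.Ω,
      2 * (F.u p * pdY F.u p + F.v p * pdY F.v p) ≤ C * (F.u p ^ 2 + F.v p ^ 2) := by
  have hcu : Continuous (pdY F.u) := (F.u_smooth.continuous_fderiv one_ne_zero).clm_apply
    continuous_const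
  have hcv : Continuous (pdY F.v) := (F.v_smooth.continuous_fderiv one_ne_zero).clm_apply
    continuous_const
  have hper : ∀ f : ℝ × ℝ → ℝ, (∀ x y, f (x + 2 * L, y) = f (x, y)) →
      ∀ x y, pdY f (x + 2 * L, y) = pdY f (x, y) := fun f hf x y => by
    have : (fun z => f (z + (2 * L, 0))) = f := by
      ext ⟨a, b⟩
      rw [Prod.mk_add_mk, add_zero, hf]
    have h := fderiv_comp_add_right (𝕜 := ℝ) (f := f) (x := (x, y)) (2 * L, 0)
    rw [this] at h
    simp [pdY, h]
  have cu := F.u_smooth.continuous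
  have cv := F.v_smooth.continuous
  set N : ℝ × ℝ → ℝ := fun p => F.u p ^ 2 + F.v p ^ 2 with hN
  set W : ℝ × ℝ → ℝ := fun p => 2 * (F.u p * pdY F.u p + F.v p * pdY F.v p) with hW
  obtain ⟨p, hp, hpm⟩ := F.exists_isMinOn_closure hL (G := N) (by fun_prop) fun x y => by
    simp only [hN, F.u_periodic, F.v_periodic]
  obtain ⟨q, hq, hqm⟩ := F.exists_isMinOn_closure hL (G := fun p => -W p) (by fun_prop)
    fun x y => by
      simp only [hW, F.u_periodic, F.v_periodic, hper _ F.u_periodic, hper _ F.v_periodic]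
  have hpos : 0 < N p := lt_of_le_of_ne (by positivity) (hstag p hp).symm
  refine ⟨|W q| / N p, by positivity, fun z hz => ?_⟩
  have h1 : N p ≤ N z := hpm hz
  have h2 : W z ≤ W q := neg_le_neg_iff.1 (hqm hz)
  calc W z ≤ |W q| := h2.trans (le_abs_self _)
    _ = |W q| / N p * N p := by field_simp
    _ ≤ |W q| / N p * N z := by gcongr

/-- The pressure with its hydrostatic part removed. -/
noncomputable def dynPressure (p : ℝ × ℝ) : ℝ := F.P p + g * p.2

theorem contDiff_dynPressure : ContDiff ℝ 2 F.dynPressure :=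
  F.P_smooth.add (contDiff_const.mul contDiff_snd)

theorem fderiv_dynPressure (p : ℝ × ℝ) :
    fderiv ℝ F.dynPressure p = fderiv ℝ F.P p + g • ContinuousLinearMap.snd ℝ ℝ ℝ :=
  (((F.P_smooth.differentiable two_ne_zero p).hasFDerivAt).add
    (hasFDerivAt_snd.const_mul g)).fderiv

theorem pdX_dynPressure (p : ℝ × ℝ) : pdX F.dynPressure p = pdX F.P p := by
  simp [pdX, fderiv_dynPressure]

theorem pdY_dynPressure (p : ℝ × ℝ) : pdY F.dynPressure p = pdY F.P p + g := by
  simp [pdY, fderiv_dynPressure]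

theorem pdY_dynPressure_bed (x : ℝ) : pdY F.dynPressure (x, -d) = 0 := by
  have hcont : ∀ {f : ℝ × ℝ → ℝ}, ContDiff ℝ 1 f → ∀ e, Continuous fun p => fderiv ℝ f p e :=
    fun hf _ => (hf.continuous_fderiv one_ne_zero).clm_apply continuous_const
  have hmem := frontier_subset_closure (F.bed_mem_frontier x)
  have cu := F.u_smooth.continuous
  have cv := F.v_smooth.continuous
  have c1 : Continuous (pdX F.v) := hcont F.v_smooth _
  have c2 : Continuous (pdY F.v) := hcont F.v_smooth _
  have c3 : Continuous (pdY F.P) := hcont (F.P_smooth.of_le one_le_two) _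
  have hE : F.u (x, -d) * pdX F.v (x, -d) + F.v (x, -d) * pdY F.v (x, -d)
      = -pdY F.P (x, -d) - g :=
    closure_minimal (t := {p | F.u p * pdX F.v p + F.v p * pdY F.v p = -pdY F.P p - g})
      F.euler_y (isClosed_eq (by fun_prop) (by fun_prop)) hmem
  have hvx : pdX F.v (x, -d) = 0 := by
    have h1 : HasDerivAt (fun t : ℝ => F.v (t, -d)) (pdX F.v (x, -d)) x :=
      (F.v_smooth.differentiable one_ne_zero (x, -d)).hasFDerivAt.comp_hasDerivAt x
        ((hasDerivAt_id x).prodMk (hasDerivAt_const x (-d)))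
    have h2 : (fun t : ℝ => F.v (t, -d)) = fun _ => 0 := funext F.bed_kinematic
    rw [h2] at h1
    exact h1.unique (hasDerivAt_const x 0)
  rw [hvx, F.bed_kinematic] at hE
  rw [pdY_dynPressure]
  linarith

section Barrier

variable {ε lam : ℝ} {p : ℝ × ℝ}

theorem hasDerivAt_vertical_barrier (t : ℝ) :
    HasDerivAt (fun t => F.dynPressure (p.1, t) - ε * Real.exp (lam * t))
      (pdY F.dynPressure (p.1, t) - ε * (lam * Real.exp (lam * t))) t := by
  have h1 : HasDerivAt (fun t : ℝ => F.dynPressure (p.1, t)) (pdY F.dynPressure (p.1, t)) t :=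
    (F.contDiff_dynPressure.differentiable two_ne_zero (p.1, t)).hasFDerivAt.comp_hasDerivAt t
      ((hasDerivAt_const t p.1).prodMk (hasDerivAt_id t))
  have h2 : HasDerivAt (fun t => Real.exp (lam * t)) (lam * Real.exp (lam * t)) t := by
    refine (((hasDerivAt_id t).const_mul lam).exp).congr_deriv ?_
    simp [mul_comm]
  exact h1.sub (h2.const_mul ε)

theorem hasDerivAt_horizontal (c t : ℝ) :
    HasDerivAt (fun t => F.dynPressure (t, p.2) - c) (pdX F.dynPressure (t, p.2)) t := by
  have h1 : HasDerivAt (fun t : ℝ => F.dynPressure (t, p.2)) (pdX F.dynPressure (t, p.2)) t :=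
    HasFDerivAt.comp_hasDerivAt (f := fun t : ℝ => (t, p.2)) t
      (F.contDiff_dynPressure.differentiable two_ne_zero (t, p.2)).hasFDerivAt
      ((hasDerivAt_id t).prodMk (hasDerivAt_const t p.2))
  exact h1.sub_const c

/-- The dynamic pressure satisfies `ΔQ + c · ∇Q = 0` with bounded `c` when the flow has no
stagnation points, so a steep exponential barrier rules out interior minima. -/
theorem not_isMinOn_of_mem {C : ℝ} (hε : 0 < ε) (hlam : 0 < lam) (hC : C < lam)
    (hbound : ∀ p ∈ closure F.Ω,
      2 * (F.u p * pdY F.u p + F.v p * pdY F.v p) ≤ C * (F.u p ^ 2 + F.v p ^ 2))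
    (hstag : ∀ p ∈ closure F.Ω, F.u p ^ 2 + F.v p ^ 2 ≠ 0) (hp : p ∈ F.Ω) :
    ¬ IsMinOn (fun z => F.dynPressure z - ε * Real.exp (lam * z.2)) (closure F.Ω) p := by
  intro hmin
  have hloc : IsLocalMin (fun z => F.dynPressure z - ε * Real.exp (lam * z.2)) p :=
    hmin.isLocalMin (mem_of_superset (F.Ω_open.mem_nhds hp) subset_closure)
  have hX : IsLocalMin (fun t => F.dynPressure (t, p.2) - ε * Real.exp (lam * p.2)) p.1 :=
    (continuous_id.prodMk (continuous_const (y := p.2))).continuousAt.eventually hloc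
  have hY : IsLocalMin (fun t => F.dynPressure (p.1, t) - ε * Real.exp (lam * t)) p.2 :=
    ((continuous_const (y := p.1)).prodMk continuous_id).continuousAt.eventually hloc
  have hQX := hX.hasDerivAt_eq_zero (F.hasDerivAt_horizontal _ _)
  have hQY := hY.hasDerivAt_eq_zero (F.hasDerivAt_vertical_barrier _)
  have hdQ : HasFDerivAt (fderiv ℝ F.dynPressure) (fderiv ℝ (fderiv ℝ F.dynPressure) p) p :=
    ((F.contDiff_dynPressure.fderiv_right (m := 1) (by norm_num)).differentiable
      one_ne_zero p).hasFDerivAt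
  have hXX := hX.second_deriv_nonneg (F.hasDerivAt_horizontal _)
    (a := fderiv ℝ (fderiv ℝ F.dynPressure) p (1, 0) (1, 0))
    ((ContinuousLinearMap.apply ℝ ℝ ((1, 0) : ℝ × ℝ)).hasFDerivAt.comp_hasDerivAt p.1
      (HasFDerivAt.comp_hasDerivAt (f := fun t : ℝ => (t, p.2)) p.1 hdQ
        ((hasDerivAt_id p.1).prodMk (hasDerivAt_const p.1 p.2))))
  have hYY := hY.second_deriv_nonneg F.hasDerivAt_vertical_barrier
    (a := fderiv ℝ (fderiv ℝ F.dynPressure) p (0, 1) (0, 1)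
      - ε * (lam * (lam * Real.exp (lam * p.2)))) (by
      have h1 := (ContinuousLinearMap.apply ℝ ℝ ((0, 1) : ℝ × ℝ)).hasFDerivAt.comp_hasDerivAt p.2
        (HasFDerivAt.comp_hasDerivAt (f := fun t : ℝ => (p.1, t)) p.2 hdQ
          ((hasDerivAt_const p.2 p.1).prodMk (hasDerivAt_id p.2)))
      have h2 : HasDerivAt (fun t => Real.exp (lam * t)) (lam * Real.exp (lam * p.2)) p.2 := by
        refine (((hasDerivAt_id p.2).const_mul lam).exp).congr_deriv ?_
        simp [mul_comm]
      exact h1.sub ((h2.const_mul lam).const_mul ε))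
  have hlap := laplacian_eq_of_steady F.Ω_open F.u_smooth F.v_smooth F.contDiff_dynPressure
    (fun z hz => by rw [pdX_dynPressure]; exact F.euler_x z hz)
    (fun z hz => by rw [pdY_dynPressure, F.euler_y z hz]; ring) F.incompressible hp
  have hx := F.euler_x p hp
  have hy := F.euler_y p hp
  have hdiv := F.incompressible p hp
  have hb := hbound p (subset_closure hp)
  rw [← pdX_dynPressure] at hx
  have hy' : F.u p * pdX F.v p + F.v p * pdY F.v p = -pdY F.dynPressure p := by
    rw [hy, pdY_dynPressure]; ring
  have hN : 0 < F.u p ^ 2 + F.v p ^ 2 :=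
    lt_of_le_of_ne (by positivity) (hstag p (subset_closure hp)).symm
  set κ := ε * (lam * Real.exp (lam * p.2)) with hκ
  have hκpos : 0 < κ := by positivity
  have hQX' : pdX F.dynPressure p = 0 := hQX
  have hQY' : pdY F.dynPressure p = κ := sub_eq_zero.1 hQY
  rw [hQX', neg_zero] at hx
  rw [hQY'] at hy'
  have hdet : (pdX F.u p * pdY F.v p - pdY F.u p * pdX F.v p) * (F.u p ^ 2 + F.v p ^ 2)
      = κ * (F.u p * pdY F.u p + F.v p * pdY F.v p) := by
    linear_combination (F.u p * pdY F.v p - F.v p * pdX F.v p) * hx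
      + (F.v p * pdX F.u p - F.u p * pdY F.u p) * hy' - κ * F.v p * hdiv
  have hge : lam * κ ≤ 2 * (pdX F.u p * pdY F.v p - pdY F.u p * pdX F.v p) := by
    rw [← hlap, hκ]
    linarith
  have h1 := mul_le_mul_of_nonneg_right hge hN.le
  have h2 := mul_le_mul_of_nonneg_left hb hκpos.le
  have h3 : 0 < (lam - C) * (κ * (F.u p ^ 2 + F.v p ^ 2)) :=
    mul_pos (sub_pos.2 hC) (mul_pos hκpos hN)
  linarith

theorem not_isMinOn_bed (hε : 0 < ε) (hlam : 0 < lam) (hp : p.2 = -d) :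
    ¬ IsMinOn (fun z => F.dynPressure z - ε * Real.exp (lam * z.2)) (closure F.Ω) p := by
  intro hmin
  have hd := F.hasDerivAt_vertical_barrier (p := p) (ε := ε) (lam := lam) (-d)
  rw [pdY_dynPressure_bed, zero_sub] at hd
  have hneg : -(ε * (lam * Real.exp (lam * -d))) < 0 := by
    have : 0 < ε * (lam * Real.exp (lam * -d)) := by positivity
    linarith
  have hslope := (hasDerivAt_iff_tendsto_slope.1 hd).mono_left
    (nhdsWithin_mono _ (show Ioi (-d) ⊆ {-d}ᶜ from fun t ht => (ne_of_gt ht)))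
  have hev := hslope.eventually (gt_mem_nhds hneg)
  obtain ⟨t, ht, ht1, ht2⟩ := (hev.and (Ioo_mem_nhdsGT F.bed_lt_minη)).exists
  have hle := hmin (subset_closure (F.strip_subset (show (p.1, t) ∈ _ from ⟨ht1, ht2⟩)))
  have hpe : p = (p.1, -d) := Prod.ext rfl hp
  rw [hpe] at hle
  rw [slope_def_field, div_neg_iff] at ht
  simp only [mem_ofPred_eq] at hle
  rcases ht with h | h
  · linarith [h.2]
  · linarith [h.1]

end Barrier

/-- Minimum principle for the dynamic pressure. -/
theorem le_dynPressure (hg : 0 < g) (hL : 0 < L)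
    (hstag : ∀ p ∈ closure F.Ω, F.u p ^ 2 + F.v p ^ 2 ≠ 0) {p : ℝ × ℝ} (hp : p ∈ closure F.Ω) :
    Patm + g * F.minη ≤ F.dynPressure p := by
  obtain ⟨C, hC0, hC⟩ := F.exists_coefficient_bound hL hstag
  obtain ⟨M, hM⟩ := F.exists_le_top hL
  have hlam : 0 < C + 1 := by positivity
  have key : ∀ ε > 0, Patm + g * F.minη
      ≤ F.dynPressure p + ε * Real.exp ((C + 1) * M) := fun ε hε => by
    obtain ⟨q, hq, hqm⟩ := F.exists_isMinOn_closure hL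
      (G := fun z => F.dynPressure z - ε * Real.exp ((C + 1) * z.2))
      (by have := F.contDiff_dynPressure.continuous; fun_prop)
      (fun x y => by simp only [dynPressure, F.P_periodic])
    have hqS : q ∈ frontier F.Ω := by
      rw [F.Ω_open.frontier_eq]
      exact ⟨hq, fun h => F.not_isMinOn_of_mem hε hlam (lt_add_one C) hC hstag h hqm⟩
    rw [F.Ω_frontier] at hqS
    rcases hqS with ⟨s, rfl⟩ | h
    · have h1 : F.dynPressure (F.X s, F.Y s) - ε * Real.exp ((C + 1) * F.Y s)
          ≤ F.dynPressure p - ε * Real.exp ((C + 1) * p.2) := hqm hp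
      have h2 : F.dynPressure (F.X s, F.Y s) = Patm + g * F.Y s := by
        rw [dynPressure, F.surface_pressure]
      have h3 : ε * Real.exp ((C + 1) * F.Y s) ≤ ε * Real.exp ((C + 1) * M) := by
        gcongr
        exact hM _ hq
      have h4 : 0 < ε * Real.exp ((C + 1) * p.2) := by positivity
      have h5 := mul_le_mul_of_nonneg_left (F.minη_le s) hg.le
      linarith
    · exact absurd hqm (F.not_isMinOn_bed hε hlam h)
  refine le_of_forall_pos_le_add fun δ hδ => ?_
  have := key (δ / Real.exp ((C + 1) * M)) (by positivity)
  rwa [div_mul_cancel₀ _ (Real.exp_ne_zero _)] at this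

end GenPeriodicFlow

/-- **Pressure below the troughs.**  For a nontrivial flow with no stagnation points in
the closure of `Ω`, the pressure exceeds atmospheric at all depths below the troughs. -/
theorem pressure_gt_atmospheric_below_troughs (g Patm L d : ℝ) (hg : 0 < g) (hL : 0 < L)
    (hd : 0 < d)
    (F : GenPeriodicFlow g Patm L d)
    (hnt : F.Nontrivial')
    (hstag : ∀ p ∈ closure F.Ω, F.u p ^ 2 + F.v p ^ 2 ≠ 0) :
    ∀ p ∈ closure F.Ω, p.2 < F.minη → Patm < F.P p := by
  intro p hp hlt
  have h := F.le_dynPressure hg hL hstag hp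
  rw [GenPeriodicFlow.dynPressure] at h
  have := mul_lt_mul_of_pos_left hlt hg
  linarith
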